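/- arXiv:1405.1701 — 3 statements merged into one kernel-verified Lean document; each statement's English description precedes it below -/
import Mathlib

section
/- Let 𝓓 = (Ω, 𝓑) be a supersimple 2-(n,4,2) design, ∞ ∈ Ω, and suppose G = π_∞(𝓓) is transitive on Ω \ {∞} and preserves a system of imprimitivity with ℓ blocks each of size k. Suppose moreover that whenever a, c ∈ Ω \ {∞} lie in the same block of imprimitivity, ∞ ∈ overline{a,c}. Then k = 3. -/
open Equiv

variable {Ω : Type*} [DecidableEq Ω] [Fintype Ω]

/-- Two points of a 4-hypergraph are collinear if they are equal or some line contains both. -/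
def HGCollinear (B : Finset (Finset Ω)) (x y : Ω) : Prop :=
  x = y ∨ ∃ b ∈ B, x ∈ b ∧ y ∈ b

/-- A 4-hypergraph is pliable if any two lines sharing three pairwise distinct points are equal. -/
def HGPliable (B : Finset (Finset Ω)) : Prop :=
  ∀ b₁ ∈ B, ∀ b₂ ∈ B, ∀ p q r : Ω, p ≠ q → p ≠ r → q ≠ r →
    p ∈ b₁ → q ∈ b₁ → r ∈ b₁ → p ∈ b₂ → q ∈ b₂ → r ∈ b₂ → b₁ = b₂

/-- `g` is the elementary move `[x,y]`: it interchanges `x` and `y`, interchanges the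
remaining two points of every line through `x` and `y`, and fixes everything else.
For `x = y` it is the identity. -/
def IsElemMove (B : Finset (Finset Ω)) (x y : Ω) (g : Equiv.Perm Ω) : Prop :=
  (x = y ∧ g = 1) ∨
  (x ≠ y ∧ (∃ b ∈ B, x ∈ b ∧ y ∈ b) ∧ g x = y ∧ g y = x ∧
    ∀ z : Ω, z ≠ x → z ≠ y →
      ((∀ b ∈ B, ¬(x ∈ b ∧ y ∈ b ∧ z ∈ b)) → g z = z) ∧
      (∀ b ∈ B, x ∈ b → y ∈ b → z ∈ b →
        ∀ w ∈ b, w ≠ x → w ≠ y → w ≠ z → g z = w))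

/-- `g` is the move sequence `[a₀,…,a_k]` recorded by the list
(elementary moves applied left to right). -/
def IsMoveSeq (B : Finset (Finset Ω)) : List Ω → Equiv.Perm Ω → Prop
  | [], _ => False
  | [_], g => g = 1
  | a :: b :: l, g => ∃ e h : Equiv.Perm Ω,
      IsElemMove B a b e ∧ IsMoveSeq B (b :: l) h ∧ g = h * e

/-- The puzzle set `𝓛_𝓓` of all move sequences. -/
def puzzleSet (B : Finset (Finset Ω)) : Set (Equiv.Perm Ω) :=
  { g | ∃ l : List Ω, IsMoveSeq B l g }

/-- The hole stabiliser `π_x(𝓓)`: all closed move sequences starting and ending at `x`. -/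
def holeStab (B : Finset (Finset Ω)) (x : Ω) : Set (Equiv.Perm Ω) :=
  { g | ∃ l : List Ω, l.head? = some x ∧ l.getLast? = some x ∧ IsMoveSeq B l g }

/-- `(Ω, B)` is a 2-(n,4,λ) design: lines have four points and every pair of distinct
points lies in exactly `lam` lines. -/
def IsTwoDesign (B : Finset (Finset Ω)) (lam : ℕ) : Prop :=
  (∀ b ∈ B, b.card = 4) ∧
  ∀ p q : Ω, p ≠ q → (B.filter fun b => p ∈ b ∧ q ∈ b).card = lam

/-- Supersimple: any two distinct lines meet in at most two points. -/
def HGSupersimple (B : Finset (Finset Ω)) : Prop :=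
  ∀ b₁ ∈ B, ∀ b₂ ∈ B, b₁ ≠ b₂ → (b₁ ∩ b₂).card ≤ 2

/-- `x ∈ overline{a,c}`: `x` is `a`, `c`, or lies on a line containing both `a` and `c`. -/
def HGLineClosure (B : Finset (Finset Ω)) (a c x : Ω) : Prop :=
  x = a ∨ x = c ∨ ∃ b ∈ B, a ∈ b ∧ c ∈ b ∧ x ∈ b

/-- A system of imprimitivity for the hole stabiliser `π_x` acting on `Ω \ {x}`,
with `ℓ` blocks each of size `k`. -/
def IsHoleBlockSystem (B : Finset (Finset Ω)) (x : Ω) (P : Finset (Finset Ω))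
    (k ℓ : ℕ) : Prop :=
  P.card = ℓ ∧ 1 < k ∧ 1 < ℓ ∧ (∀ Δ ∈ P, Δ.card = k) ∧
  (∀ a : Ω, a ≠ x → ∃! Δ : Finset Ω, Δ ∈ P ∧ a ∈ Δ) ∧
  (∀ Δ ∈ P, x ∉ Δ) ∧
  (∀ g ∈ holeStab B x, ∀ Δ ∈ P, Δ.image (⇑g) ∈ P)

omit [Fintype Ω] in
/-- Two lines of a supersimple hypergraph sharing three distinct points are equal. -/
theorem HGSupersimple.hgPliable {B : Finset (Finset Ω)} (h : HGSupersimple B) :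
    HGPliable B := by
  intro b₁ h₁ b₂ h₂ p q r hpq hpr hqr hp₁ hq₁ hr₁ hp₂ hq₂ hr₂
  by_contra hne
  have hsub : ({p, q, r} : Finset Ω) ⊆ b₁ ∩ b₂ := by
    intro z hz
    simp only [Finset.mem_insert, Finset.mem_singleton] at hz
    rcases hz with rfl | rfl | rfl <;> simp [*]
  have hle := (Finset.card_le_card hsub).trans (h b₁ h₁ b₂ h₂ hne)
  rw [Finset.card_eq_three.2 ⟨p, q, r, hpq, hpr, hqr, rfl⟩] at hle
  omega

omit [Fintype Ω] in
/-- Two of any three lines through a given pair of points coincide when `lam = 2`. -/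
theorem IsTwoDesign.eq_or_eq_or_eq {B : Finset (Finset Ω)} (h : IsTwoDesign B 2)
    {p q : Ω} (hpq : p ≠ q) {b₁ b₂ b₃ : Finset Ω}
    (h₁ : b₁ ∈ B ∧ p ∈ b₁ ∧ q ∈ b₁) (h₂ : b₂ ∈ B ∧ p ∈ b₂ ∧ q ∈ b₂)
    (h₃ : b₃ ∈ B ∧ p ∈ b₃ ∧ q ∈ b₃) : b₁ = b₂ ∨ b₁ = b₃ ∨ b₂ = b₃ := by
  obtain ⟨c₁, c₂, -, hc⟩ := Finset.card_eq_two.1 (h.2 p q hpq)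
  have key : ∀ b, b ∈ B ∧ p ∈ b ∧ q ∈ b → b = c₁ ∨ b = c₂ := by
    intro b hb
    have : b ∈ B.filter fun b => p ∈ b ∧ q ∈ b := Finset.mem_filter.2 hb
    simpa [hc] using this
  grind

omit [Fintype Ω] in
/-- A line through two distinct points has exactly two further points. -/
theorem IsTwoDesign.exists_pair {B : Finset (Finset Ω)} {lam : ℕ} (h : IsTwoDesign B lam)
    {b : Finset Ω} (hb : b ∈ B) {p q : Ω} (hpq : p ≠ q) (hp : p ∈ b) (hq : q ∈ b) :
    ∃ u v, u ≠ v ∧ u ≠ p ∧ u ≠ q ∧ v ≠ p ∧ v ≠ q ∧ b = {p, q, u, v} := by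
  have hcard : (b \ {p, q}).card = 2 := by
    rw [Finset.card_sdiff_of_subset (by grind), h.1 b hb, Finset.card_pair hpq]
  obtain ⟨u, v, huv, huv'⟩ := Finset.card_eq_two.1 hcard
  have key : ∀ z, (z ∈ b ∧ z ≠ p ∧ z ≠ q) ↔ z = u ∨ z = v := by
    intro z
    have := Finset.ext_iff.1 huv' z
    simpa using this
  refine ⟨u, v, huv, ?_, ?_, ?_, ?_, ?_⟩
  · exact ((key u).2 (Or.inl rfl)).2.1
  · exact ((key u).2 (Or.inl rfl)).2.2
  · exact ((key v).2 (Or.inr rfl)).2.1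
  · exact ((key v).2 (Or.inr rfl)).2.2
  · ext z
    have := key z
    simp only [Finset.mem_insert, Finset.mem_singleton]
    grind

omit [Fintype Ω] in
/-- A line contains a point different from any three given points. -/
theorem IsTwoDesign.exists_mem_ne {B : Finset (Finset Ω)} {lam : ℕ} (h : IsTwoDesign B lam)
    {b : Finset Ω} (hb : b ∈ B) (p q r : Ω) : ∃ w ∈ b, w ≠ p ∧ w ≠ q ∧ w ≠ r := by
  have hlt : ({p, q, r} : Finset Ω).card < b.card := by
    have := Finset.card_le_three (a := p) (b := q) (c := r)
    rw [h.1 b hb]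
    omega
  obtain ⟨w, hw, hw'⟩ := Finset.exists_mem_notMem_of_card_lt_card hlt
  simp only [Finset.mem_insert, Finset.mem_singleton, not_or] at hw'
  exact ⟨w, hw, hw'⟩

omit [Fintype Ω] in
/-- Every pair of distinct points of a pliable design with `lam = 2` has an elementary move. -/
theorem IsTwoDesign.exists_isElemMove {B : Finset (Finset Ω)} (h : IsTwoDesign B 2)
    (hB : HGPliable B) {p q : Ω} (hpq : p ≠ q) : ∃ g, IsElemMove B p q g := by
  obtain ⟨b₁, b₂, hne, hc⟩ := Finset.card_eq_two.1 (h.2 p q hpq)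
  have key : ∀ b, (b ∈ B ∧ p ∈ b ∧ q ∈ b) ↔ b = b₁ ∨ b = b₂ := by
    intro b
    have := Finset.ext_iff.1 hc b
    simpa using this
  obtain ⟨hb₁, hp₁, hq₁⟩ := (key b₁).2 (Or.inl rfl)
  obtain ⟨hb₂, hp₂, hq₂⟩ := (key b₂).2 (Or.inr rfl)
  obtain ⟨u, v, huv, hup, huq, hvp, hvq, e₁⟩ := h.exists_pair hb₁ hpq hp₁ hq₁
  obtain ⟨s, t, hst, hsp, hsq, htp, htq, e₂⟩ := h.exists_pair hb₂ hpq hp₂ hq₂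
  have hdisj : ∀ z, z ≠ p → z ≠ q → z ∈ b₁ → z ∉ b₂ := fun z hzp hzq hz₁ hz₂ =>
    hne (hB b₁ hb₁ b₂ hb₂ p q z hpq hzp.symm hzq.symm hp₁ hq₁ hz₁ hp₂ hq₂ hz₂)
  have hu := hdisj u hup huq (by simp [e₁])
  have hv := hdisj v hvp hvq (by simp [e₁])
  simp only [e₂, Finset.mem_insert, Finset.mem_singleton, not_or] at hu hv
  obtain ⟨-, -, hus, hut⟩ := hu
  obtain ⟨-, -, hvs, hvt⟩ := hv
  refine ⟨swap p q * swap u v * swap s t, Or.inr ⟨hpq, ⟨b₁, hb₁, hp₁, hq₁⟩, ?_, ?_, ?_⟩⟩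
  · simp only [Perm.mul_apply, swap_apply_def]
    grind
  · simp only [Perm.mul_apply, swap_apply_def]
    grind
  intro z hzp hzq
  refine ⟨fun hz => ?_, fun b hb hpb hqb hzb w hwb hwp hwq hwz => ?_⟩
  · have hz₁ := hz b₁ hb₁
    have hz₂ := hz b₂ hb₂
    simp only [e₁, e₂, Finset.mem_insert, Finset.mem_singleton] at hz₁ hz₂
    simp only [Perm.mul_apply, swap_apply_def]
    grind
  · simp only [Perm.mul_apply, swap_apply_def]
    rcases (key b).1 ⟨hb, hpb, hqb⟩ with rfl | rfl
    · simp only [e₁, Finset.mem_insert, Finset.mem_singleton] at hzb hwb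
      grind
    · simp only [e₂, Finset.mem_insert, Finset.mem_singleton] at hzb hwb
      grind

omit [Fintype Ω] in
/-- If `{x, a, d, c}` is a line, the triangle `[x, a, d, x]` fixes `d`.  Hence if
every element of the hole stabiliser fixing `d` also fixes a point `e` on a line through `x` and
`d`, then `x`, `a`, `e` lie on a line. -/
theorem IsTwoDesign.exists_line_of_fixed {B : Finset (Finset Ω)} (h : IsTwoDesign B 2)
    (hB : HGPliable B) {x a d c e : Ω} (hxa : x ≠ a) (hxd : x ≠ d) (hxc : x ≠ c)
    (had : a ≠ d) (hac : a ≠ c) (hdc : d ≠ c)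
    {b : Finset Ω} (hb : b ∈ B) (hxb : x ∈ b) (hab : a ∈ b) (hdb : d ∈ b) (hcb : c ∈ b)
    {b' : Finset Ω} (hb' : b' ∈ B) (hxb' : x ∈ b') (hdb' : d ∈ b') (heb' : e ∈ b')
    (hex : e ≠ x) (hed : e ≠ d) (hea : e ≠ a)
    (hfix : ∀ g ∈ holeStab B x, g d = d → g e = e) :
    ∃ l ∈ B, x ∈ l ∧ a ∈ l ∧ e ∈ l := by
  by_contra! hno
  obtain ⟨E₁, h₁⟩ := h.exists_isElemMove hB hxa
  obtain ⟨E₂, h₂⟩ := h.exists_isElemMove hB had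
  obtain ⟨E₃, h₃⟩ := h.exists_isElemMove hB hxd.symm
  have hg : E₃ * E₂ * E₁ ∈ holeStab B x :=
    ⟨[x, a, d, x], rfl, rfl, E₁, E₃ * E₂, h₁, ⟨E₂, E₃, h₂, ⟨E₃, 1, h₃, rfl, by simp⟩, rfl⟩, rfl⟩
  obtain ⟨-, -, h₁x, h₁a, h₁z⟩ := h₁.resolve_left (by tauto)
  obtain ⟨-, -, h₂a, h₂d, h₂z⟩ := h₂.resolve_left (by tauto)
  obtain ⟨-, -, h₃d, h₃x, h₃z⟩ := h₃.resolve_left (by tauto)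
  have hgd : (E₃ * E₂ * E₁) d = d := by
    have i₁ := (h₁z d hxd.symm had.symm).2 b hb hxb hab hdb c hcb hxc.symm hac.symm hdc.symm
    have i₂ := (h₂z c hac.symm hdc.symm).2 b hb hab hdb hcb x hxb hxa hxd hxc
    simp [Perm.mul_apply, i₁, i₂, h₃x]
  have hge := hfix _ hg hgd
  obtain ⟨m, hm, hme, hmd, hmx⟩ := h.exists_mem_ne hb' e d x
  have i₃ := (h₃z m hmd hmx).2 b' hb' hdb' hxb' hm e heb' hed hex hme.symm
  have i₁ : E₁ e = e := (h₁z e hex hea).1 fun l hl ⟨hx, ha, he⟩ => hno l hl hx ha he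
  have i₂ : E₂ e = m := by
    apply E₃.injective
    rw [i₃]
    simpa [Perm.mul_apply, i₁] using hge
  by_cases hl : ∃ l ∈ B, a ∈ l ∧ d ∈ l ∧ e ∈ l
  · obtain ⟨l, hl, hal, hdl, hel⟩ := hl
    have hml : m ∈ l := by
      obtain ⟨w, hwl, hwa, hwd, hwe⟩ := h.exists_mem_ne hl a d e
      rwa [← i₂, (h₂z e hea hed).2 l hl hal hdl hel w hwl hwa hwd hwe]
    have := hB l hl b' hb' d e m hed.symm hmd.symm hme.symm hdl hel hml hdb' heb' hm
    exact hno b' hb' hxb' (this ▸ hal) heb'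
  · push Not at hl
    have := (h₂z e hea hed).1 fun l hl' ⟨ha, hd, he⟩ => hl l hl' ha hd he
    exact hme (i₂.symm.trans this)

omit [Fintype Ω] in
/-- Given a line `{x, a, b, c}`, a further point `d` is not joined to all of `a`, `b`, `c` by lines
through `x`. -/
theorem IsTwoDesign.not_joined_to_line {B : Finset (Finset Ω)} (h : IsTwoDesign B 2)
    (hB : HGPliable B) {x a b c d : Ω} (hxa : x ≠ a) (hxb : x ≠ b) (hxc : x ≠ c)
    (hab : a ≠ b) (hac : a ≠ c) (hbc : b ≠ c) (hxd : x ≠ d)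
    (had : a ≠ d) (hbd : b ≠ d) (hcd : c ≠ d)
    {l : Finset Ω} (hl : l ∈ B) (hxl : x ∈ l) (hal : a ∈ l) (hbl : b ∈ l) (hcl : c ∈ l)
    (ha : ∃ l ∈ B, x ∈ l ∧ a ∈ l ∧ d ∈ l) (hb : ∃ l ∈ B, x ∈ l ∧ b ∈ l ∧ d ∈ l)
    (hc : ∃ l ∈ B, x ∈ l ∧ c ∈ l ∧ d ∈ l) : False := by
  have hdl : d ∉ l := by
    intro hdl
    have hsub : ({x, a, b, c, d} : Finset Ω) ⊆ l := by
      simp [Finset.insert_subset_iff, *]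
    have hle := Finset.card_le_card hsub
    rw [h.1 l hl, Finset.card_insert_of_notMem (by simp [*]),
      Finset.card_insert_of_notMem (by simp [*]), Finset.card_insert_of_notMem (by simp [*]),
      Finset.card_pair hcd] at hle
    omega
  apply hdl
  obtain ⟨l₁, hl₁, hx₁, ha₁, hd₁⟩ := ha
  obtain ⟨l₂, hl₂, hx₂, hb₂, hd₂⟩ := hb
  obtain ⟨l₃, hl₃, hx₃, hc₃, hd₃⟩ := hc
  rcases h.eq_or_eq_or_eq hxd ⟨hl₁, hx₁, hd₁⟩ ⟨hl₂, hx₂, hd₂⟩ ⟨hl₃, hx₃, hd₃⟩ with rfl | rfl | rfl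
  · rwa [hB l hl l₁ hl₁ x a b hxa hxb hab hxl hal hbl hx₁ ha₁ hb₂]
  · rwa [hB l hl l₁ hl₁ x a c hxa hxc hac hxl hal hcl hx₁ ha₁ hc₃]
  · rwa [hB l hl l₂ hl₂ x b c hxb hxc hbc hxl hbl hcl hx₂ hb₂ hc₃]

omit [Fintype Ω] in
/-- Four points other than `x` are never pairwise joined by lines through `x`. -/
theorem IsTwoDesign.card_le_three {B : Finset (Finset Ω)} (h : IsTwoDesign B 2)
    (hB : HGPliable B) {x : Ω} {s : Finset Ω} (hx : x ∉ s)
    (hs : ∀ a ∈ s, ∀ c ∈ s, a ≠ c → ∃ l ∈ B, x ∈ l ∧ a ∈ l ∧ c ∈ l) : s.card ≤ 3 := by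
  by_contra! hcard
  obtain ⟨t, hts, htc⟩ := Finset.exists_subset_card_eq (show 4 ≤ s.card by omega)
  obtain ⟨a, b, c, d, hab, hac, had, hbc, hbd, hcd, rfl⟩ := Finset.card_eq_four.1 htc
  have no_line : ∀ p ∈ s, ∀ q ∈ s, ∀ r ∈ s, ∀ w ∈ s, p ≠ q → p ≠ r → q ≠ r → p ≠ w → q ≠ w →
      r ≠ w → ∀ l ∈ B, x ∈ l → p ∈ l → q ∈ l → r ∈ l → False := by
    intro p hp q hq r hr w hw hpq hpr hqr hpw hqw hrw l hl hxl hpl hql hrl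
    have hne : ∀ z ∈ s, x ≠ z := fun z hz hxz => hx (hxz ▸ hz)
    exact h.not_joined_to_line hB (hne p hp) (hne q hq) (hne r hr) hpq hpr hqr (hne w hw) hpw hqw
      hrw hl hxl hpl hql hrl (hs p hp w hw hpw) (hs q hq w hw hqw) (hs r hr w hw hrw)
  have ha : a ∈ s := hts (by simp)
  have hb : b ∈ s := hts (by simp)
  have hc : c ∈ s := hts (by simp)
  have hd : d ∈ s := hts (by simp)
  obtain ⟨l₁, hl₁, hx₁, ha₁, hb₁⟩ := hs a ha b hb hab
  obtain ⟨l₂, hl₂, hx₂, ha₂, hc₂⟩ := hs a ha c hc hac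
  obtain ⟨l₃, hl₃, hx₃, ha₃, hd₃⟩ := hs a ha d hd had
  have hxa : x ≠ a := fun e => hx (e ▸ ha)
  rcases h.eq_or_eq_or_eq hxa ⟨hl₁, hx₁, ha₁⟩ ⟨hl₂, hx₂, ha₂⟩ ⟨hl₃, hx₃, ha₃⟩ with rfl | rfl | rfl
  · exact no_line a ha b hb c hc d hd hab hac hbc had hbd hcd l₁ hl₁ hx₁ ha₁ hb₁ hc₂
  · exact no_line a ha b hb d hd c hc hab had hbd hac hbc hcd.symm l₁ hl₁ hx₁ ha₁ hb₁ hd₃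
  · exact no_line a ha c hc d hd b hb hac had hcd hab hbc.symm hbd.symm l₂ hl₂ hx₂ ha₂ hc₂ hd₃

/-- (Lemma 5.4) For a supersimple 2-(n,4,2) design: if the hole
stabilizer is transitive, preserves a system of imprimitivity with `ℓ` blocks of size
`k`, and points in a common block always satisfy `∞ ∈ overline{a,c}`, then `k = 3`. -/
theorem stmt10 (B : Finset (Finset Ω)) (n : ℕ) (hn : Fintype.card Ω = n)
    (hdes : IsTwoDesign B 2) (hss : HGSupersimple B) (x : Ω)
    (htrans : ∀ a b : Ω, a ≠ x → b ≠ x → ∃ g ∈ holeStab B x, g a = b)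
    (P : Finset (Finset Ω)) (k ℓ : ℕ) (hP : IsHoleBlockSystem B x P k ℓ)
    (hsame : ∀ a c : Ω, a ≠ x → c ≠ x → a ≠ c →
      (∃ Δ ∈ P, a ∈ Δ ∧ c ∈ Δ) → HGLineClosure B a c x) :
    k = 3 := by
  obtain ⟨rfl, hk, hl, hPk, hPu, hPx, hPg⟩ := hP
  have hB := hss.hgPliable
  have hline : ∀ Δ ∈ P, ∀ a ∈ Δ, ∀ c ∈ Δ, a ≠ c → ∃ l ∈ B, x ∈ l ∧ a ∈ l ∧ c ∈ l := by
    intro Δ hΔ a ha c hc hac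
    have hax : a ≠ x := fun e => hPx Δ hΔ (e ▸ ha)
    have hcx : c ≠ x := fun e => hPx Δ hΔ (e ▸ hc)
    rcases hsame a c hax hcx hac ⟨Δ, hΔ, ha, hc⟩ with e | e | ⟨l, hl, hal, hcl, hxl⟩
    · exact absurd e.symm hax
    · exact absurd e.symm hcx
    · exact ⟨l, hl, hxl, hal, hcl⟩
  obtain ⟨Δ, hΔ⟩ := Finset.card_pos.1 (show 0 < P.card by omega)
  have hk3 : k ≤ 3 := hPk Δ hΔ ▸ hdes.card_le_three hB (hPx Δ hΔ) (hline Δ hΔ)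
  suffices hk2 : k ≠ 2 by omega
  rintro rfl
  obtain ⟨a, c, hac, rfl⟩ := Finset.card_eq_two.1 (hPk Δ hΔ)
  obtain ⟨b, hb, hxb, hab, hcb⟩ := hline _ hΔ a (by simp) c (by simp) hac
  have hxa : x ≠ a := fun e => hPx _ hΔ (by simp [e])
  have hxc : x ≠ c := fun e => hPx _ hΔ (by simp [e])
  obtain ⟨d, hdb, hda, hdc, hdx⟩ := hdes.exists_mem_ne hb a c x
  obtain ⟨Δ', ⟨hΔ', hdΔ'⟩, huniq⟩ := hPu d hdx
  obtain ⟨e, hed, rfl⟩ : ∃ e, e ≠ d ∧ Δ' = {d, e} := by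
    obtain ⟨y, z, hyz, rfl⟩ := Finset.card_eq_two.1 (hPk Δ' hΔ')
    simp only [Finset.mem_insert, Finset.mem_singleton] at hdΔ'
    rcases hdΔ' with rfl | rfl
    · exact ⟨z, hyz.symm, rfl⟩
    · exact ⟨y, hyz, Finset.pair_comm _ _⟩
  have hex : e ≠ x := fun h => hPx _ hΔ' (by simp [h])
  have hne : ({a, c} : Finset Ω) ≠ {d, e} := by
    intro h
    have : d ∈ ({a, c} : Finset Ω) := by simp [h]
    simp [hda, hdc] at this
  have heΔ : e ∉ ({a, c} : Finset Ω) := fun h =>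
    hne ((hPu e hex).unique ⟨hΔ, h⟩ ⟨hΔ', by simp⟩)
  simp only [Finset.mem_insert, Finset.mem_singleton, not_or] at heΔ
  obtain ⟨hea, hec⟩ := heΔ
  have hfix : ∀ g ∈ holeStab B x, g d = d → g e = e := by
    intro g hg hgd
    have himg := huniq _ ⟨hPg g hg _ hΔ', Finset.mem_image.2 ⟨d, by simp, hgd⟩⟩
    have hge : g e ∈ ({d, e} : Finset Ω) := by
      rw [← himg]
      exact Finset.mem_image_of_mem _ (by simp)
    simp only [Finset.mem_insert, Finset.mem_singleton] at hge
    exact hge.resolve_left fun h => hed (g.injective (h.trans hgd.symm))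
  obtain ⟨b', hb', hxb', hdb', heb'⟩ := hline _ hΔ' d (by simp) e (by simp) hed.symm
  have hla := hdes.exists_line_of_fixed hB hxa hdx.symm hxc hda.symm hac hdc hb hxb hab hdb hcb
    hb' hxb' hdb' heb' hex hed hea hfix
  have hlc := hdes.exists_line_of_fixed hB hxc hdx.symm hxa hdc.symm hac.symm hda hb hxb hcb hdb
    hab hb' hxb' hdb' heb' hex hed hec hfix
  exact hdes.not_joined_to_line hB hxa hxc hdx.symm hac hda.symm hdc.symm hex.symm (Ne.symm hea)
    (Ne.symm hec) hed.symm hb hxb hab hcb hdb hla hlc ⟨b', hb', hxb', hdb', heb'⟩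
end

section
/- Let 𝓓 = (Ω, 𝓑) be a supersimple 2-(n,4,λ) design with λ ∈ {1, 2} and let ∞ ∈ Ω. Then either the hole stabilizer G = π_∞(𝓓) acts primitively on Ω \ {∞} (i.e. transitively and preserving no system of imprimitivity), or n ≤ 13 when λ = 1, respectively n ≤ 25 when λ = 2. -/
open Equiv

variable {Ω : Type*} [DecidableEq Ω] [Fintype Ω]

/-- Some line contains `p`, `q` and `z`. -/
def OnCommonLine (B : Finset (Finset Ω)) (p q z : Ω) : Prop :=
  ∃ b ∈ B, p ∈ b ∧ q ∈ b ∧ z ∈ b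

omit [DecidableEq Ω] [Fintype Ω] in
lemma OnCommonLine.swap_left {B : Finset (Finset Ω)} {p q z : Ω} (h : OnCommonLine B p q z) :
    OnCommonLine B q p z := by
  obtain ⟨b, hb, h₁, h₂, h₃⟩ := h
  exact ⟨b, hb, h₂, h₁, h₃⟩

omit [DecidableEq Ω] [Fintype Ω] in
lemma OnCommonLine.swap_right {B : Finset (Finset Ω)} {p q z : Ω} (h : OnCommonLine B p q z) :
    OnCommonLine B p z q := by
  obtain ⟨b, hb, h₁, h₂, h₃⟩ := h
  exact ⟨b, hb, h₁, h₃, h₂⟩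

open Classical in
/-- The points other than `p` and `q` on the lines through `p` and `q`. -/
noncomputable def thirdPoints (B : Finset (Finset Ω)) (p q : Ω) : Finset Ω :=
  Finset.univ.filter fun z => z ≠ p ∧ z ≠ q ∧ OnCommonLine B p q z

lemma mem_thirdPoints {B : Finset (Finset Ω)} {p q z : Ω} :
    z ∈ thirdPoints B p q ↔ z ≠ p ∧ z ≠ q ∧ OnCommonLine B p q z := by
  simp [thirdPoints]

lemma card_thirdPoints_le {B : Finset (Finset Ω)} {lam : ℕ} (hdes : IsTwoDesign B lam)
    {p q : Ω} (hpq : p ≠ q) : (thirdPoints B p q).card ≤ 2 * lam := by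
  have hsub : thirdPoints B p q ⊆
      (B.filter fun b => p ∈ b ∧ q ∈ b).biUnion fun b => b \ {p, q} := by
    intro z hz
    obtain ⟨hzp, hzq, b, hb, h₁, h₂, h₃⟩ := mem_thirdPoints.1 hz
    simp only [Finset.mem_biUnion, Finset.mem_filter, Finset.mem_sdiff, Finset.mem_insert,
      Finset.mem_singleton]
    exact ⟨b, ⟨hb, h₁, h₂⟩, h₃, by tauto⟩
  refine (Finset.card_le_card hsub).trans ?_
  rw [mul_comm, ← hdes.2 p q hpq]
  refine Finset.card_biUnion_le_card_mul _ _ _ fun b hb => ?_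
  obtain ⟨hb, h₁, h₂⟩ := Finset.mem_filter.1 hb
  have hss : ({p, q} : Finset Ω) ⊆ b := by
    simp [Finset.insert_subset_iff, h₁, h₂]
  rw [Finset.card_sdiff_of_subset hss, hdes.1 b hb, Finset.card_pair hpq]

omit [Fintype Ω] in
lemma HGSupersimple.line_unique {B : Finset (Finset Ω)} (hss : HGSupersimple B)
    {b₁ b₂ : Finset Ω} (h₁ : b₁ ∈ B) (h₂ : b₂ ∈ B) {p q r : Ω} (hpq : p ≠ q) (hpr : p ≠ r)
    (hqr : q ≠ r) (hp₁ : p ∈ b₁) (hq₁ : q ∈ b₁) (hr₁ : r ∈ b₁) (hp₂ : p ∈ b₂) (hq₂ : q ∈ b₂)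
    (hr₂ : r ∈ b₂) : b₁ = b₂ := by
  by_contra hne
  have hsub : ({p, q, r} : Finset Ω) ⊆ b₁ ∩ b₂ := by
    simp [Finset.insert_subset_iff, *]
  have := Finset.card_le_card hsub
  rw [Finset.card_eq_three.2 ⟨p, q, r, hpq, hpr, hqr, rfl⟩] at this
  have := hss b₁ h₁ b₂ h₂ hne
  omega

omit [Fintype Ω] in
lemma eq_of_mem_of_card_eq_four {b : Finset Ω} (hb : b.card = 4) {p q z v w : Ω}
    (hp : p ∈ b) (hq : q ∈ b) (hz : z ∈ b) (hv : v ∈ b) (hw : w ∈ b) (hpq : p ≠ q)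
    (hzp : z ≠ p) (hzq : z ≠ q) (hvp : v ≠ p) (hvq : v ≠ q) (hvz : v ≠ z)
    (hwp : w ≠ p) (hwq : w ≠ q) (hwz : w ≠ z) : v = w := by
  by_contra hvw
  have hsub : ({p, q, z, v, w} : Finset Ω) ⊆ b := by
    simp [Finset.insert_subset_iff, *]
  have := Finset.card_le_card hsub
  have h5 : ({p, q, z, v, w} : Finset Ω).card = 5 := by
    rw [Finset.card_insert_of_notMem, Finset.card_insert_of_notMem,
      Finset.card_eq_three.2 ⟨z, v, w, hvz.symm, hwz.symm, hvw, rfl⟩] <;>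
    simp <;> tauto
  omega

/-- `w` is the fourth point of a line through `p`, `q` and `z`. -/
def IsFourthPoint (B : Finset (Finset Ω)) (p q z w : Ω) : Prop :=
  z ≠ p ∧ z ≠ q ∧ w ≠ p ∧ w ≠ q ∧ w ≠ z ∧ ∃ b ∈ B, p ∈ b ∧ q ∈ b ∧ z ∈ b ∧ w ∈ b

omit [DecidableEq Ω] [Fintype Ω] in
lemma IsFourthPoint.symm {B : Finset (Finset Ω)} {p q z w : Ω} (h : IsFourthPoint B p q z w) :
    IsFourthPoint B p q w z := by
  obtain ⟨h₁, h₂, h₃, h₄, h₅, b, hb, h₆, h₇, h₈, h₉⟩ := h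
  exact ⟨h₃, h₄, h₁, h₂, h₅.symm, b, hb, h₆, h₇, h₉, h₈⟩

omit [Fintype Ω] in
lemma IsFourthPoint.unique {B : Finset (Finset Ω)} {lam : ℕ} (hdes : IsTwoDesign B lam)
    (hss : HGSupersimple B) {p q z v w : Ω} (hpq : p ≠ q) (hv : IsFourthPoint B p q z v)
    (hw : IsFourthPoint B p q z w) : v = w := by
  obtain ⟨h₁, h₂, h₃, h₄, h₅, b, hb, h₆, h₇, h₈, h₉⟩ := hv
  obtain ⟨-, -, k₃, k₄, k₅, c, hc, k₆, k₇, k₈, k₉⟩ := hw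
  obtain rfl := hss.line_unique hb hc hpq h₁.symm h₂.symm h₆ h₇ h₈ k₆ k₇ k₈
  exact eq_of_mem_of_card_eq_four (hdes.1 b hb) h₆ h₇ h₈ h₉ k₉ hpq h₁ h₂ h₃ h₄ h₅ k₃ k₄ k₅

lemma exists_isElemMove {B : Finset (Finset Ω)} {lam : ℕ} (hlam : 0 < lam)
    (hdes : IsTwoDesign B lam) (hss : HGSupersimple B) {p q : Ω} (hpq : p ≠ q) :
    ∃ e, IsElemMove B p q e := by
  classical
  let f : Ω → Ω := fun z => if z = p then q else if z = q then p else
    if h : ∃ w, IsFourthPoint B p q z w then h.choose else z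
  have fp : f p = q := by simp [f]
  have fq : f q = p := by simp [f, hpq.symm]
  have fw : ∀ z w, IsFourthPoint B p q z w → f z = w := by
    intro z w h
    have hex : ∃ w, IsFourthPoint B p q z w := ⟨w, h⟩
    simp only [f, if_neg h.1, if_neg h.2.1, dif_pos hex]
    exact hex.choose_spec.unique hdes hss hpq h
  have ff : ∀ z, z ≠ p → z ≠ q → (¬ ∃ w, IsFourthPoint B p q z w) → f z = z := by
    intro z h₁ h₂ h₃
    simp only [f, if_neg h₁, if_neg h₂, dif_neg h₃]
  have hinv : Function.Involutive f := by
    intro z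
    by_cases h₁ : z = p
    · rw [h₁, fp, fq]
    by_cases h₂ : z = q
    · rw [h₂, fq, fp]
    by_cases h₃ : ∃ w, IsFourthPoint B p q z w
    · obtain ⟨w, hw⟩ := h₃
      rw [fw z w hw, fw w z hw.symm]
    · rw [ff z h₁ h₂ h₃, ff z h₁ h₂ h₃]
  have hline : ∃ b ∈ B, p ∈ b ∧ q ∈ b := by
    have := hdes.2 p q hpq
    obtain ⟨b, hb⟩ := Finset.card_pos.1 (this ▸ hlam)
    exact ⟨b, (Finset.mem_filter.1 hb).1, (Finset.mem_filter.1 hb).2⟩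
  refine ⟨hinv.toPerm, Or.inr ⟨hpq, hline, fp, fq, fun z hzp hzq => ⟨fun h => ?_, ?_⟩⟩⟩
  · refine ff z hzp hzq ?_
    rintro ⟨w, -, -, -, -, -, b, hb, h₁, h₂, h₃, -⟩
    exact h b hb ⟨h₁, h₂, h₃⟩
  · intro b hb h₁ h₂ h₃ w hw hwp hwq hwz
    exact fw z w ⟨hzp, hzq, hwp, hwq, hwz, b, hb, h₁, h₂, h₃, hw⟩

section ElemMove

variable {B : Finset (Finset Ω)} {p q : Ω} {e : Perm Ω}

omit [DecidableEq Ω] [Fintype Ω] in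
lemma IsElemMove.apply_left (h : IsElemMove B p q e) : e p = q := by
  rcases h with ⟨rfl, rfl⟩ | ⟨-, -, h, -⟩
  · rfl
  · exact h

omit [DecidableEq Ω] [Fintype Ω] in
lemma IsElemMove.apply_right (h : IsElemMove B p q e) : e q = p := by
  rcases h with ⟨rfl, rfl⟩ | ⟨-, -, -, h, -⟩
  · rfl
  · exact h

omit [DecidableEq Ω] [Fintype Ω] in
lemma IsElemMove.apply_of_not_onCommonLine (h : IsElemMove B p q e) {z : Ω} (hzp : z ≠ p)
    (hzq : z ≠ q) (hz : ¬ OnCommonLine B p q z) : e z = z := by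
  rcases h with ⟨rfl, rfl⟩ | ⟨-, -, -, -, h⟩
  · rfl
  · exact (h z hzp hzq).1 fun b hb hz' => hz ⟨b, hb, hz'⟩

end ElemMove

/-- If `x`, `a`, `c` are not on a common line, the closed move sequence `[x,c,a,x]` swaps `a` and
`c`, and away from the lines through `x`, `c` and through `c`, `a` it acts as the last move. -/
lemma exists_swap_mem_holeStab {B : Finset (Finset Ω)} {lam : ℕ} (hlam : 0 < lam)
    (hdes : IsTwoDesign B lam) (hss : HGSupersimple B) {x a c : Ω} (hax : a ≠ x) (hcx : c ≠ x)
    (hac : a ≠ c) (hline : ¬ OnCommonLine B x a c) {e : Perm Ω} (he : IsElemMove B a x e) :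
    ∃ g ∈ holeStab B x, g a = c ∧ g c = a ∧
      ∀ z, z ≠ a → z ≠ c → z ≠ x → ¬ OnCommonLine B x c z → ¬ OnCommonLine B c a z →
        g z = e z := by
  obtain ⟨e₁, h₁⟩ := exists_isElemMove hlam hdes hss hcx.symm
  obtain ⟨e₂, h₂⟩ := exists_isElemMove hlam hdes hss hac.symm
  refine ⟨e * e₂ * e₁, ⟨[x, c, a, x], rfl, rfl, ?_⟩, ?_, ?_, ?_⟩
  · exact ⟨e₁, e * e₂, h₁, ⟨e₂, e, h₂, ⟨e, 1, he, rfl, by simp⟩, rfl⟩, rfl⟩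
  · rw [Perm.mul_apply, Perm.mul_apply, h₁.apply_of_not_onCommonLine hax hac
      fun h => hline h.swap_right, h₂.apply_right, he.apply_of_not_onCommonLine hac.symm hcx
      fun h => hline h.swap_left]
  · rw [Perm.mul_apply, Perm.mul_apply, h₁.apply_right, h₂.apply_of_not_onCommonLine hcx.symm
      hax.symm fun h => hline h.swap_right.swap_left.swap_right, he.apply_right]
  · intro z hza hzc hzx hz₁ hz₂
    rw [Perm.mul_apply, Perm.mul_apply, h₁.apply_of_not_onCommonLine hzx hzc hz₁,
      h₂.apply_of_not_onCommonLine hzc hza hz₂]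

lemma exists_not_onCommonLine {B : Finset (Finset Ω)} {lam : ℕ} (hdes : IsTwoDesign B lam)
    (hn : 4 * lam + 3 < Fintype.card Ω) {x a b : Ω} (hax : a ≠ x) (hbx : b ≠ x) :
    ∃ d, d ≠ x ∧ d ≠ a ∧ d ≠ b ∧ ¬ OnCommonLine B x a d ∧ ¬ OnCommonLine B x b d := by
  have hcard : ({x, a, b} ∪ thirdPoints B x a ∪ thirdPoints B x b).card <
      (Finset.univ : Finset Ω).card := by
    have h₁ := Finset.card_union_le ({x, a, b} ∪ thirdPoints B x a) (thirdPoints B x b)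
    have h₂ := Finset.card_union_le {x, a, b} (thirdPoints B x a)
    have h₃ := Finset.card_le_three (a := x) (b := a) (c := b)
    have h₄ := card_thirdPoints_le hdes hax.symm
    have h₅ := card_thirdPoints_le hdes hbx.symm
    rw [Finset.card_univ]
    omega
  obtain ⟨d, -, hd⟩ := Finset.exists_mem_notMem_of_card_lt_card hcard
  simp only [Finset.mem_union, Finset.mem_insert, Finset.mem_singleton, mem_thirdPoints] at hd
  exact ⟨d, by tauto⟩

lemma holeStab_transitive {B : Finset (Finset Ω)} {lam : ℕ} (hlam : 0 < lam)
    (hdes : IsTwoDesign B lam) (hss : HGSupersimple B) (hn : 4 * lam + 3 < Fintype.card Ω)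
    {x a b : Ω} (hax : a ≠ x) (hbx : b ≠ x) : ∃ g ∈ holeStab B x, g a = b := by
  have hmove : ∀ {u v : Ω}, u ≠ x → v ≠ x → u ≠ v → ¬ OnCommonLine B x u v →
      ∃ g ∈ holeStab B x, g u = v := by
    intro u v hu hv huv hl
    obtain ⟨e, he⟩ := exists_isElemMove hlam hdes hss hu
    obtain ⟨g, hg, h, -⟩ := exists_swap_mem_holeStab hlam hdes hss hu hv huv hl he
    exact ⟨g, hg, h⟩
  obtain ⟨d, hdx, hda, hdb, h₁, h₂⟩ := exists_not_onCommonLine hdes hn hax hbx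
  obtain ⟨e₁, he₁⟩ := exists_isElemMove hlam hdes hss hdx.symm
  obtain ⟨e₂, he₂⟩ := exists_isElemMove hlam hdes hss hda
  obtain ⟨e₃, he₃⟩ := exists_isElemMove hlam hdes hss hax
  obtain ⟨e₄, he₄⟩ := exists_isElemMove hlam hdes hss hbx.symm
  obtain ⟨e₅, he₅⟩ := exists_isElemMove hlam hdes hss hdb.symm
  obtain ⟨e₆, he₆⟩ := exists_isElemMove hlam hdes hss hdx
  refine ⟨e₆ * e₅ * e₄ * e₃ * e₂ * e₁, ⟨[x, d, a, x, b, d, x], rfl, rfl, ?_⟩, ?_⟩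
  · refine ⟨e₁, _, he₁, ⟨e₂, _, he₂, ⟨e₃, _, he₃, ⟨e₄, _, he₄, ⟨e₅, _, he₅,
      ⟨e₆, _, he₆, rfl, rfl⟩, rfl⟩, rfl⟩, rfl⟩, rfl⟩, ?_⟩
    simp only [one_mul, mul_assoc]
  · simp only [Perm.mul_apply]
    rw [he₁.apply_of_not_onCommonLine hax hda.symm fun h => h₁ h.swap_right, he₂.apply_right,
      he₃.apply_of_not_onCommonLine hda hdx fun h => h₁ h.swap_left,
      he₄.apply_of_not_onCommonLine hdx hdb h₂, he₅.apply_right,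
      he₆.apply_of_not_onCommonLine hdb.symm hbx fun h => h₂ h.swap_left.swap_right]

section BlockSystem

variable {B P : Finset (Finset Ω)} {x : Ω} {k ℓ : ℕ}

omit [Fintype Ω] in
lemma IsHoleBlockSystem.eq_of_mem (hP : IsHoleBlockSystem B x P k ℓ) {Δ Δ' : Finset Ω}
    (h : Δ ∈ P) (h' : Δ' ∈ P) {a : Ω} (ha : a ∈ Δ) (ha' : a ∈ Δ') : Δ = Δ' := by
  obtain ⟨-, -, -, -, huniq, hx, -⟩ := hP
  have hax : a ≠ x := by
    rintro rfl
    exact hx Δ h ha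
  exact (huniq a hax).unique ⟨h, ha⟩ ⟨h', ha'⟩

/-- Some two points of different blocks are not on a line with the hole. -/
lemma IsHoleBlockSystem.exists_blocks {lam : ℕ} (hdes : IsTwoDesign B lam)
    (hn : 4 * lam + 3 < Fintype.card Ω) (hP : IsHoleBlockSystem B x P k ℓ) :
    ∃ Δ ∈ P, ∃ Δ' ∈ P, Δ ≠ Δ' ∧ ∃ a ∈ Δ, ∃ c ∈ Δ', ¬ OnCommonLine B x a c := by
  obtain ⟨hPc, hk, hℓ, hcard, huniq, hx, -⟩ := hP
  obtain ⟨Δ, Δ', hΔ, hΔ', hne⟩ := Finset.one_lt_card_iff.1 (hPc ▸ hℓ)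
  obtain ⟨a, ha⟩ : Δ.Nonempty := Finset.card_pos.1 (by rw [hcard Δ hΔ]; omega)
  obtain ⟨c, hc⟩ : Δ'.Nonempty := Finset.card_pos.1 (by rw [hcard Δ' hΔ']; omega)
  have hax : a ≠ x := fun h => hx Δ hΔ (h ▸ ha)
  have hcx : c ≠ x := fun h => hx Δ' hΔ' (h ▸ hc)
  obtain ⟨d, hdx, hda, hdc, h₁, h₂⟩ := exists_not_onCommonLine hdes hn hax hcx
  obtain ⟨Δ'', ⟨hΔ'', hd⟩, -⟩ := huniq d hdx
  by_cases h : Δ = Δ''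
  · exact ⟨Δ', hΔ', Δ'', hΔ'', fun h' => hne (h.trans h'.symm), c, hc, d, hd, h₂⟩
  · exact ⟨Δ, hΔ, Δ'', hΔ'', h, a, ha, d, hd, h₁⟩

lemma IsHoleBlockSystem.block_card_le {lam : ℕ} (hlam : 0 < lam)
    (hdes : IsTwoDesign B lam) (hss : HGSupersimple B) (hn : 4 * lam + 3 < Fintype.card Ω)
    (hP : IsHoleBlockSystem B x P k ℓ) : k ≤ 3 * lam + 1 := by
  obtain ⟨Δ, hΔ, Δ', hΔ', hne, a, ha, c, hc, hl⟩ := hP.exists_blocks hdes hn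
  have hdisj : ∀ z, z ∈ Δ → z ∈ Δ' → False := fun z h h' => hne (hP.eq_of_mem hΔ hΔ' h h')
  have heq := fun Δ Δ' a h h' ha ha' => hP.eq_of_mem (Δ := Δ) (Δ' := Δ') (a := a) h h' ha ha'
  obtain ⟨-, hk, -, hcard, -, hx, hinv⟩ := hP
  have hax : a ≠ x := fun h => hx Δ hΔ (h ▸ ha)
  have hcx : c ≠ x := fun h => hx Δ' hΔ' (h ▸ hc)
  have hac : a ≠ c := by
    rintro rfl
    exact hdisj a ha hc
  obtain ⟨e, he⟩ := exists_isElemMove hlam hdes hss hax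
  obtain ⟨g, hg, hga, hgc, hgz⟩ := exists_swap_mem_holeStab hlam hdes hss hax hcx hac hl he
  have him : Δ.image g = Δ' :=
    heq _ _ c (hinv g hg Δ hΔ) hΔ' (Finset.mem_image.2 ⟨a, ha, hga⟩) hc
  have him' : Δ'.image g = Δ :=
    heq _ _ a (hinv g hg Δ' hΔ') hΔ (Finset.mem_image.2 ⟨c, hc, hgc⟩) ha
  have hsub : Δ ∪ Δ' ⊆ {a, c} ∪ thirdPoints B x c ∪ thirdPoints B c a ∪ thirdPoints B a x := by
    intro z hz
    have hzx : z ≠ x := by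
      rintro rfl
      rcases Finset.mem_union.1 hz with h | h
      exacts [hx Δ hΔ h, hx Δ' hΔ' h]
    have hmoved : g z ≠ z := by
      intro hfix
      rcases Finset.mem_union.1 hz with h | h
      · exact hdisj z h (him ▸ Finset.mem_image.2 ⟨z, h, hfix⟩)
      · exact hdisj z (him' ▸ Finset.mem_image.2 ⟨z, h, hfix⟩) h
    by_contra hnot
    simp only [Finset.mem_union, Finset.mem_insert, Finset.mem_singleton, mem_thirdPoints]
      at hnot
    have hza : z ≠ a := by tauto
    have hzc : z ≠ c := by tauto
    apply hmoved
    rw [hgz z hza hzc hzx (by tauto) (by tauto),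
      he.apply_of_not_onCommonLine hza hzx (by tauto)]
  have h₀ := Finset.card_le_card hsub
  rw [Finset.card_union_of_disjoint (Finset.disjoint_left.2 fun z h h' => hdisj z h h'),
    hcard Δ hΔ, hcard Δ' hΔ'] at h₀
  have h₁ := Finset.card_union_le ({a, c} ∪ thirdPoints B x c ∪ thirdPoints B c a)
    (thirdPoints B a x)
  have h₂ := Finset.card_union_le ({a, c} ∪ thirdPoints B x c) (thirdPoints B c a)
  have h₃ := Finset.card_union_le {a, c} (thirdPoints B x c)
  have h₄ := Finset.card_le_two (a := a) (b := c)
  have h₅ := card_thirdPoints_le hdes hcx.symm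
  have h₆ := card_thirdPoints_le hdes hac.symm
  have h₇ := card_thirdPoints_le hdes hax
  omega

/-- Given two points `b`, `b'` of a block `Δ`, every point off `Δ`, the hole, and the lines joining
two of `x`, `b`, `b'` is in the block of the image of `b'` under the move `[b,x]`. -/
lemma IsHoleBlockSystem.univ_subset {lam : ℕ} (hlam : 0 < lam)
    (hdes : IsTwoDesign B lam) (hss : HGSupersimple B) (hP : IsHoleBlockSystem B x P k ℓ)
    {Δ Δ' : Finset Ω} (hΔ : Δ ∈ P) (hΔ' : Δ' ∈ P) {b b' : Ω} (hb : b ∈ Δ) (hb' : b' ∈ Δ)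
    (hbb' : b ≠ b') {e : Perm Ω} (he : IsElemMove B b x e) (heb' : e b' ∈ Δ') :
    Finset.univ ⊆ {x} ∪ Δ ∪ Δ' ∪ thirdPoints B x b ∪ thirdPoints B x b' ∪
      thirdPoints B b b' := by
  intro c _
  by_contra hnot
  simp only [Finset.mem_union, Finset.mem_singleton, mem_thirdPoints] at hnot
  have hbx : b ≠ x := fun h => hP.2.2.2.2.2.1 Δ hΔ (h ▸ hb)
  have hbx' : b' ≠ x := fun h => hP.2.2.2.2.2.1 Δ hΔ (h ▸ hb')
  have hcx : c ≠ x := by tauto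
  have hcb : c ≠ b := by
    rintro rfl
    tauto
  have hcb' : c ≠ b' := by
    rintro rfl
    tauto
  have hl₁ : ¬ OnCommonLine B x b c := by tauto
  have hl₂ : ¬ OnCommonLine B x b' c := by tauto
  have hl₃ : ¬ OnCommonLine B b b' c := by tauto
  obtain ⟨g, hg, hgb, -, hgz⟩ :=
    exists_swap_mem_holeStab hlam hdes hss hbx hcx hcb.symm hl₁ he
  have hgb' : g b' = e b' := hgz b' hbb'.symm hcb'.symm hbx' (fun h => hl₂ h.swap_right)
    fun h => hl₃ h.swap_left.swap_right
  have him : Δ.image g = Δ' := hP.eq_of_mem (hP.2.2.2.2.2.2 g hg Δ hΔ) hΔ'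
    (Finset.mem_image.2 ⟨b', hb', hgb'⟩) heb'
  have : c ∈ Δ' := him ▸ Finset.mem_image.2 ⟨b, hb, hgb⟩
  tauto

lemma IsHoleBlockSystem.card_le {lam : ℕ} (hlam : 0 < lam) (hdes : IsTwoDesign B lam)
    (hss : HGSupersimple B) (hP : IsHoleBlockSystem B x P k ℓ) :
    Fintype.card Ω ≤ 12 * lam + 1 := by
  by_contra hlt
  have hk := hP.block_card_le hlam hdes hss (by omega)
  have hsub := fun Δ Δ' b b' e => hP.univ_subset (Δ := Δ) (Δ' := Δ') (b := b) (b' := b') (e := e)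
    hlam hdes hss
  obtain ⟨hPc, hk₁, hℓ, hcard, huniq, hx, -⟩ := hP
  obtain ⟨Δ, hΔ⟩ : P.Nonempty := Finset.card_pos.1 (by omega)
  obtain ⟨b, b', hb, hb', hbb'⟩ := Finset.one_lt_card_iff.1 ((hcard Δ hΔ).symm ▸ hk₁)
  have hbx : b ≠ x := fun h => hx Δ hΔ (h ▸ hb)
  have hbx' : b' ≠ x := fun h => hx Δ hΔ (h ▸ hb')
  obtain ⟨e, he⟩ := exists_isElemMove hlam hdes hss hbx
  have hex : e b' ≠ x := fun h => hbb' (e.injective (he.apply_left.trans h.symm))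
  obtain ⟨Δ', ⟨hΔ', heb'⟩, -⟩ := huniq (e b') hex
  have h₁ := card_thirdPoints_le hdes hbx.symm
  have h₂ := card_thirdPoints_le hdes hbx'.symm
  have h₃ := card_thirdPoints_le hdes hbb'
  have hΔc := hcard Δ hΔ
  have hΔc' := hcard Δ' hΔ'
  by_cases hl : OnCommonLine B x b b'
  · have hsub' : Finset.univ ⊆ {x} ∪ Δ ∪ Δ' ∪ (thirdPoints B x b).erase b' ∪
        (thirdPoints B x b').erase b ∪ (thirdPoints B b b').erase x := by
      intro c hc
      have hmem := hsub Δ Δ' b b' e hΔ hΔ' hb hb' hbb' he heb' hc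
      simp only [Finset.mem_union, Finset.mem_singleton, Finset.mem_erase] at hmem ⊢
      rcases eq_or_ne c x with hcx | hcx
      · simp only [hcx, true_or]
      rcases eq_or_ne c b with hcb | hcb
      · simp only [hcb, hb, true_or, or_true]
      rcases eq_or_ne c b' with hcb' | hcb'
      · simp only [hcb', hb', true_or, or_true]
      simpa only [ne_eq, hcx, hcb, hcb', not_false_eq_true, true_and] using hmem
    have h₀ := Finset.card_le_card hsub'
    rw [Finset.card_univ] at h₀
    have u₁ := Finset.card_union_le ({x} ∪ Δ ∪ Δ' ∪ (thirdPoints B x b).erase b' ∪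
      (thirdPoints B x b').erase b) ((thirdPoints B b b').erase x)
    have u₂ := Finset.card_union_le ({x} ∪ Δ ∪ Δ' ∪ (thirdPoints B x b).erase b')
      ((thirdPoints B x b').erase b)
    have u₃ := Finset.card_union_le ({x} ∪ Δ ∪ Δ') ((thirdPoints B x b).erase b')
    have u₄ := Finset.card_union_le ({x} ∪ Δ) Δ'
    have u₅ := Finset.card_union_le {x} Δ
    rw [Finset.card_singleton] at u₅
    rw [Finset.card_erase_of_mem (mem_thirdPoints.2 ⟨hbx', hbb'.symm, hl⟩)] at u₃
    rw [Finset.card_erase_of_mem (mem_thirdPoints.2 ⟨hbx, hbb', hl.swap_right⟩)] at u₂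
    rw [Finset.card_erase_of_mem (mem_thirdPoints.2
      ⟨hbx.symm, hbx'.symm, hl.swap_left.swap_right⟩)] at u₁
    omega
  · have hfix : e b' = b' :=
      he.apply_of_not_onCommonLine hbb'.symm hbx' fun h => hl h.swap_left
    have h₀ := Finset.card_le_card
      (hsub Δ Δ b b' e hΔ hΔ hb hb' hbb' he (hfix.symm ▸ hb'))
    rw [Finset.card_univ, Finset.union_assoc {x} Δ Δ, Finset.union_self] at h₀
    have u₁ := Finset.card_union_le ({x} ∪ Δ ∪ thirdPoints B x b ∪ thirdPoints B x b')
      (thirdPoints B b b')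
    have u₂ := Finset.card_union_le ({x} ∪ Δ ∪ thirdPoints B x b) (thirdPoints B x b')
    have u₃ := Finset.card_union_le ({x} ∪ Δ) (thirdPoints B x b)
    have u₄ := Finset.card_union_le {x} Δ
    rw [Finset.card_singleton] at u₄
    omega

end BlockSystem

/-- (Corollary 5.7) For a supersimple 2-(n,4,λ) design with
`λ ∈ {1, 2}`: either the hole stabilizer acts primitively on `Ω \ {∞}` (transitively,
preserving no system of imprimitivity), or `n ≤ 13` (when `λ = 1`), respectively
`n ≤ 25` (when `λ = 2`). -/
theorem stmt13 (B : Finset (Finset Ω)) (n lam : ℕ) (hn : Fintype.card Ω = n)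
    (hlam : lam = 1 ∨ lam = 2) (hdes : IsTwoDesign B lam) (hss : HGSupersimple B)
    (x : Ω) :
    ((∀ a b : Ω, a ≠ x → b ≠ x → ∃ g ∈ holeStab B x, g a = b) ∧
      ¬ ∃ (P : Finset (Finset Ω)) (k ℓ : ℕ), IsHoleBlockSystem B x P k ℓ) ∨
    (lam = 1 ∧ n ≤ 13) ∨ (lam = 2 ∧ n ≤ 25) := by
  have hpos : 0 < lam := by omega
  by_cases hbig : 12 * lam + 1 < n
  · refine Or.inl ⟨fun a b ha hb => holeStab_transitive hpos hdes hss (by omega) ha hb, ?_⟩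
    rintro ⟨P, k, ℓ, hP⟩
    have := hP.card_le hpos hdes hss
    omega
  · omega
end

section
/- Let H be a group of permutations of a finite set X acting transitively, and suppose H preserves a system of imprimitivity of X with ℓ ≥ 2 blocks each of size k. Then every subset S of H with ⟨S⟩ = H contains an element whose support has size at least 2k. -/
open scoped Pointwise in

/-- (Lemma 6.2) Let `H` be a transitive group of permutations of a
finite set `X` preserving a system of imprimitivity with `ℓ ≥ 2` blocks each of size
`k > 1`. Then every generating set of `H` contains an element whose support has size at
least `2k`. -/
theorem stmt14 {X : Type*} [Fintype X] [DecidableEq X]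
    (H : Subgroup (Equiv.Perm X))
    (htrans : ∀ a b : X, ∃ h ∈ H, h a = b)
    (P : Finset (Finset X)) (k ℓ : ℕ)
    (hcard : P.card = ℓ) (hℓ : 2 ≤ ℓ) (hk : 1 < k)
    (hsize : ∀ Δ ∈ P, Δ.card = k)
    (hpart : ∀ p : X, ∃! Δ : Finset X, Δ ∈ P ∧ p ∈ Δ)
    (hinv : ∀ h ∈ H, ∀ Δ ∈ P, Δ.image (⇑h) ∈ P)
    (S : Set (Equiv.Perm X)) (hgen : Subgroup.closure S = H) :
    ∃ g ∈ S, 2 * k ≤ g.support.card := by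
  classical
  have hdisj : ∀ Δ ∈ P, ∀ Γ ∈ P, Δ ≠ Γ → Disjoint Δ Γ := fun Δ hΔ Γ hΓ hne =>
    Finset.disjoint_left.2 fun x hx hx' => hne ((hpart x).unique ⟨hΔ, hx⟩ ⟨hΓ, hx'⟩)
  by_contra! hsmall
  have hfix : ∀ g ∈ S, ∀ Δ ∈ P, Δ.image g = Δ := by
    intro g hg Δ hΔ
    by_contra hne
    have himg : Δ.image g ∈ P := hinv g (hgen ▸ Subgroup.subset_closure hg) Δ hΔ
    have hd := hdisj _ himg _ hΔ hne
    have hmoved : Δ ⊆ g.support := fun x hx => Equiv.Perm.mem_support.2 fun hgx =>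
      Finset.disjoint_left.1 hd (Finset.mem_image.2 ⟨x, hx, hgx⟩) hx
    have himg_moved : Δ.image g ⊆ g.support := Finset.image_subset_iff.2 fun x hx =>
      Equiv.Perm.apply_mem_support.2 (hmoved hx)
    have hle := Finset.card_le_card (Finset.union_subset himg_moved hmoved)
    rw [Finset.card_union_of_disjoint hd, hsize _ himg, hsize _ hΔ] at hle
    have := hsmall g hg
    omega
  obtain ⟨Δ, hΔ, Γ, hΓ, hne⟩ := Finset.one_lt_card.1 (show 1 < P.card by omega)
  obtain ⟨a, ha⟩ := Finset.card_pos.1 (show 0 < Δ.card by rw [hsize Δ hΔ]; omega)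
  obtain ⟨b, hb⟩ := Finset.card_pos.1 (show 0 < Γ.card by rw [hsize Γ hΓ]; omega)
  obtain ⟨h, hh, rfl⟩ := htrans a b
  have hstab : Subgroup.closure S ≤ MulAction.stabilizer (Equiv.Perm X) (Δ : Set X) := by
    rw [Subgroup.closure_le]
    intro g hg
    rw [SetLike.mem_coe, MulAction.mem_stabilizer_iff]
    change g '' (Δ : Set X) = Δ
    rw [← Finset.coe_image, hfix g hg Δ hΔ]
  have hmem : h '' (Δ : Set X) = Δ := MulAction.mem_stabilizer_iff.1 (hstab (hgen ▸ hh))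
  have hmemΔ : h a ∈ Δ := Finset.mem_coe.1 (hmem ▸ Set.mem_image_of_mem h (Finset.mem_coe.2 ha))
  exact Finset.disjoint_left.1 (hdisj Δ hΔ Γ hΓ hne) hmemΔ hb
end
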